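/- Let n ≥ 2 be even, let a ∈ ℂⁿ, and let Ω ⊆ ℂⁿ be open. Define the Möbius (Kelvin) map ψ(z) = −(z+a)/s(z+a) ∈ ℂⁿ (so that ι(ψ(z)) = ι(z+a)⁻¹) on the open set Ω' = {z ∈ ℂⁿ : s(z+a) ≠ 0 and ψ(z) ∈ Ω}. If F : Ω → Cl_n(ℂ) is complex left monogenic, then the function z ↦ G(z+a)·F(ψ(z)) is complex left monogenic on Ω'. -/

import Mathlib

noncomputable section
open MeasureTheory
open scoped BigOperators ENNReal

/-- ℂⁿ with its Euclidean norm. -/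
abbrev Cn (n : ℕ) := EuclideanSpace ℂ (Fin n)
/-- ℝⁿ with its Euclidean norm. -/
abbrev Rn (n : ℕ) := EuclideanSpace ℝ (Fin n)

/-- `s z = z₁² + ⋯ + zₙ²`. -/
def sC (n : ℕ) (z : Cn n) : ℂ := ∑ j, z j ^ 2

/-- The quadratic form `Q z = -(z₁² + ⋯ + zₙ²)` on ℂⁿ. -/
def Qf (n : ℕ) : QuadraticForm ℂ (Cn n) :=
  (QuadraticMap.weightedSumSquares ℂ (fun _ : Fin n => (-1 : ℂ))).comp
    (WithLp.linearEquiv 2 ℂ (Fin n → ℂ)).toLinearMap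

/-- The complex Clifford algebra `Cl_n(ℂ)`. -/
abbrev Cl (n : ℕ) := CliffordAlgebra (Qf n)

/-- The structure map `ι : ℂⁿ → Cl_n(ℂ)`. -/
def ιC (n : ℕ) : Cn n →ₗ[ℂ] Cl n := CliffordAlgebra.ι (Qf n)

/-- The `j`-th standard basis vector of ℂⁿ. -/
def eC (n : ℕ) (j : Fin n) : Cn n := EuclideanSpace.single j 1
/-- The `j`-th standard basis vector of ℝⁿ. -/
def eR (n : ℕ) (j : Fin n) : Rn n := EuclideanSpace.single j 1

/-- The componentwise embedding ℝⁿ → ℂⁿ. -/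
def jmap (n : ℕ) (x : Rn n) : Cn n := (WithLp.equiv 2 (Fin n → ℂ)).symm fun i => (x i : ℂ)

/-- The complex Cauchy kernel `G(z) = s(z)^{-n/2} • ι(z)` (for `n` even). -/
def Gc (n : ℕ) (z : Cn n) : Cl n := ((sC n z) ^ (n / 2))⁻¹ • ιC n z

/-- The Euclidean Cauchy kernel `G(x) = ι(x)/‖x‖ⁿ`, `x ∈ ℝⁿ ∖ {0} ⊆ ℂⁿ`. -/
def Gr (n : ℕ) (x : Rn n) : Cl n := (((‖x‖ ^ n : ℝ) : ℂ))⁻¹ • ιC n (jmap n x)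

/-- `f : ℝⁿ → Cl_n(ℂ)` is differentiable on `U` with coordinate partial derivatives
`Df x j = (∂f/∂x_j)(x)`, tested against all `ℂ`-linear functionals of the
(finite-dimensional) Clifford algebra. -/
def HasPartialDerivsOn (n : ℕ) (f : Rn n → Cl n) (Df : Rn n → Fin n → Cl n)
    (U : Set (Rn n)) : Prop :=
  ∀ φ : Cl n →ₗ[ℂ] ℂ, ∀ x ∈ U, DifferentiableAt ℝ (fun y => φ (f y)) x ∧
    ∀ j : Fin n, fderiv ℝ (fun y => φ (f y)) x (eR n j) = φ (Df x j)

/-- `f` is left monogenic on `U`: it is differentiable and `∑ⱼ ι(eⱼ) · ∂f/∂xⱼ = 0` on `U`. -/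
def IsLeftMonogenicOn (n : ℕ) (f : Rn n → Cl n) (U : Set (Rn n)) : Prop :=
  ∃ Df : Rn n → Fin n → Cl n, HasPartialDerivsOn n f Df U ∧
    ∀ x ∈ U, ∑ j, ιC n (eC n j) * Df x j = 0

/-- `f` is right monogenic on `U`: it is differentiable and `∑ⱼ (∂f/∂xⱼ) · ι(eⱼ) = 0` on `U`. -/
def IsRightMonogenicOn (n : ℕ) (f : Rn n → Cl n) (U : Set (Rn n)) : Prop :=
  ∃ Df : Rn n → Fin n → Cl n, HasPartialDerivsOn n f Df U ∧
    ∀ x ∈ U, ∑ j, Df x j * ιC n (eC n j) = 0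

/-- `F : ℂⁿ → Cl_n(ℂ)` is holomorphic on `Ω` with complex coordinate partial
derivatives `DF z j = (∂F/∂z_j)(z)`, tested against all `ℂ`-linear functionals. -/
def HasCPartialDerivsOn (n : ℕ) (F : Cn n → Cl n) (DF : Cn n → Fin n → Cl n)
    (Ω : Set (Cn n)) : Prop :=
  ∀ φ : Cl n →ₗ[ℂ] ℂ, ∀ z ∈ Ω, DifferentiableAt ℂ (fun w => φ (F w)) z ∧
    ∀ j : Fin n, fderiv ℂ (fun w => φ (F w)) z (eC n j) = φ (DF z j)

/-- `F : ℂⁿ → Cl_n(ℂ)` is holomorphic (ℂ-differentiable) on `Ω`. -/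
def IsHolomorphicOn (n : ℕ) (F : Cn n → Cl n) (Ω : Set (Cn n)) : Prop :=
  ∀ φ : Cl n →ₗ[ℂ] ℂ, ∀ z ∈ Ω, DifferentiableAt ℂ (fun w => φ (F w)) z

/-- `F` is complex left monogenic on `Ω`: holomorphic with `∑ⱼ ι(eⱼ) · ∂F/∂zⱼ = 0` on `Ω`. -/
def IsCLeftMonogenicOn (n : ℕ) (F : Cn n → Cl n) (Ω : Set (Cn n)) : Prop :=
  ∃ DF : Cn n → Fin n → Cl n, HasCPartialDerivsOn n F DF Ω ∧
    ∀ z ∈ Ω, ∑ j, ιC n (eC n j) * DF z j = 0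

/-- `F` is complex right monogenic on `Ω`: holomorphic with `∑ⱼ (∂F/∂zⱼ) · ι(eⱼ) = 0` on `Ω`. -/
def IsCRightMonogenicOn (n : ℕ) (F : Cn n → Cl n) (Ω : Set (Cn n)) : Prop :=
  ∃ DF : Cn n → Fin n → Cl n, HasCPartialDerivsOn n F DF Ω ∧
    ∀ z ∈ Ω, ∑ j, DF z j * ιC n (eC n j) = 0

/-- The Möbius (Kelvin) map `ψ(z) = -(z+a)/s(z+a)`, satisfying `ι(ψ z) = ι(z+a)⁻¹`. -/
def mob (n : ℕ) (a : Cn n) (z : Cn n) : Cn n := (-(sC n (z + a))⁻¹) • (z + a)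

theorem eC_apply {n : ℕ} (j i : Fin n) : eC n j i = if i = j then 1 else 0 := by
  simp [eC]

theorem Cn.sum_smul_eC {n : ℕ} (v : Cn n) : ∑ i, v i • eC n i = v := by
  ext k
  simp [eC_apply]

theorem Qf_apply (n : ℕ) (z : Cn n) : Qf n z = -sC n z := by
  simp [Qf, sC, QuadraticMap.weightedSumSquares_apply, pow_two]

theorem ιC_mul_self (n : ℕ) (z : Cn n) : ιC n z * ιC n z = (-sC n z) • (1 : Cl n) := by
  rw [ιC, CliffordAlgebra.ι_sq_scalar, Qf_apply, Algebra.algebraMap_eq_smul_one]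

theorem sC_eC (n : ℕ) (j : Fin n) : sC n (eC n j) = 1 := by
  simp [sC, eC_apply]

theorem ιC_eC_mul (n : ℕ) (j : Fin n) (x : Cn n) :
    ιC n (eC n j) * ιC n x = -(ιC n x * ιC n (eC n j)) - (2 * x j) • (1 : Cl n) := by
  have hpolar : QuadraticMap.polar (Qf n) (eC n j) x = -(2 * x j) := by
    simp only [QuadraticMap.polar, Qf_apply, sC, PiLp.add_apply, add_sq, Finset.sum_add_distrib]
    simp [eC_apply]
    ring
  have h := CliffordAlgebra.ι_mul_ι_add_swap (Q := Qf n) (eC n j) x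
  rw [hpolar, Algebra.algebraMap_eq_smul_one] at h
  rw [ιC, eq_sub_of_add_eq h]
  module

theorem hasFDerivAt_coord {n : ℕ} (a : Cn n) (i : Fin n) (z : Cn n) :
    HasFDerivAt (fun w : Cn n => (w + a) i) (EuclideanSpace.proj i : Cn n →L[ℂ] ℂ) z := by
  simpa using ((EuclideanSpace.proj i : Cn n →L[ℂ] ℂ).hasFDerivAt (x := z)).add_const (a i)

theorem hasFDerivAt_sC_add {n : ℕ} (a z : Cn n) :
    HasFDerivAt (fun w => sC n (w + a))
      (∑ i, (2 * (z + a) i) • (EuclideanSpace.proj i : Cn n →L[ℂ] ℂ)) z := by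
  unfold sC
  refine HasFDerivAt.fun_sum fun i _ => ?_
  simpa [mul_add] using (hasFDerivAt_coord a i z).pow 2

/-- The derivative of the Möbius map. -/
theorem hasFDerivAt_mob {n : ℕ} (a z : Cn n) (hz : sC n (z + a) ≠ 0) :
    ∃ M : Cn n →L[ℂ] Cn n, HasFDerivAt (mob n a) M z ∧ ∀ j, M (eC n j) =
      (-(sC n (z + a))⁻¹) • eC n j + (2 * (z + a) j * ((sC n (z + a))⁻¹) ^ 2) • (z + a) := by
  have h := (((hasDerivAt_inv hz).comp_hasFDerivAt z (hasFDerivAt_sC_add a z)).neg).smul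
    ((hasFDerivAt_id z).add_const a)
  refine ⟨_, h, fun j => ?_⟩
  simp [eC_apply]
  module

theorem HasCPartialDerivsOn.hasFDerivAt {n : ℕ} {F : Cn n → Cl n} {DF : Cn n → Fin n → Cl n}
    {Ω : Set (Cn n)} (h : HasCPartialDerivsOn n F DF Ω) (φ : Cl n →ₗ[ℂ] ℂ) {z : Cn n}
    (hz : z ∈ Ω) : ∃ L : Cn n →L[ℂ] ℂ, HasFDerivAt (fun w => φ (F w)) L z ∧
      ∀ v : Cn n, L v = φ (∑ i, v i • DF z i) := by
  obtain ⟨hd, hj⟩ := h φ z hz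
  refine ⟨_, hd.hasFDerivAt, fun v => ?_⟩
  conv_lhs => rw [← Cn.sum_smul_eC v]
  simp [hj]

/-- Leibniz rule for `z ↦ (z + a) * H z`, where `H` is differentiable in the weak sense. -/
theorem hasFDerivAt_ιC_add_mul {n : ℕ} (a z : Cn n) (H : Cn n → Cl n) (T : Cn n → Cl n)
    (hH : ∀ φ : Cl n →ₗ[ℂ] ℂ, ∃ L : Cn n →L[ℂ] ℂ,
      HasFDerivAt (fun w => φ (H w)) L z ∧ ∀ v, L v = φ (T v)) (φ : Cl n →ₗ[ℂ] ℂ) :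
    ∃ L : Cn n →L[ℂ] ℂ, HasFDerivAt (fun w => φ (ιC n (w + a) * H w)) L z ∧
      ∀ v, L v = φ (ιC n v * H z + ιC n (z + a) * T v) := by
  choose L hL hLv using fun i : Fin n => hH (φ ∘ₗ LinearMap.mulLeft ℂ (ιC n (eC n i)))
  have expand : ∀ (x : Cn n) (y : Cl n),
      φ (ιC n x * y) = ∑ i, x i * φ (ιC n (eC n i) * y) := fun x y => by
    conv_lhs => rw [← Cn.sum_smul_eC x]
    simp [Finset.sum_mul]
  have h := HasFDerivAt.fun_sum (u := Finset.univ)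
    fun i (_ : i ∈ Finset.univ) => (hasFDerivAt_coord a i z).mul (hL i)
  refine ⟨_, h.congr_of_eventuallyEq (.of_forall fun w => ?_), fun v => ?_⟩
  · exact expand (w + a) (H w)
  · rw [map_add, expand v, expand (z + a)]
    simp [hLv, Finset.sum_add_distrib, add_comm, mul_comm]

theorem sum_ιC_mul_Gc_leibniz (n : ℕ) (x : Cn n) (c s : ℂ) (hs : s ≠ 0) (hsx : sC n x = s)
    (f : Cl n) (D : Fin n → Cl n) (hD : ∑ j, ιC n (eC n j) * D j = 0) :
    ∑ j, ιC n (eC n j) * ((-(n * c * s⁻¹ * x j)) • (ιC n x * f) +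
      c • (ιC n (eC n j) * f + ιC n x *
        ((-s⁻¹) • D j + (2 * x j * s⁻¹ ^ 2) • ∑ i, x i • D i))) = 0 := by
  have hx : ιC n x * ιC n x = (-s) • (1 : Cl n) := by rw [ιC_mul_self, hsx]
  have hsum : ∀ y : Cl n, ∑ j, x j • (ιC n (eC n j) * y) = ιC n x * y := fun y => by
    conv_rhs => rw [← Cn.sum_smul_eC x]
    simp [Finset.sum_mul]
  have hterm : ∀ j, ιC n (eC n j) * ((-(n * c * s⁻¹ * x j)) • (ιC n x * f) +
      c • (ιC n (eC n j) * f + ιC n x *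
        ((-s⁻¹) • D j + (2 * x j * s⁻¹ ^ 2) • ∑ i, x i • D i))) =
      (-(n * c * s⁻¹)) • (x j • (ιC n (eC n j) * (ιC n x * f))) + (-c) • f
      + (c * s⁻¹) • (ιC n x * (ιC n (eC n j) * D j)) + (2 * c * s⁻¹) • (x j • D j)
      + (2 * c * s⁻¹ ^ 2) • (x j • (ιC n (eC n j) * (ιC n x * ∑ i, x i • D i))) := fun j => by
    have h1 : ιC n (eC n j) * (ιC n (eC n j) * f) = -f := by
      rw [← mul_assoc, ιC_mul_self, sC_eC]; simp
    have h2 : ιC n (eC n j) * (ιC n x * D j) =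
        -(ιC n x * (ιC n (eC n j) * D j)) - (2 * x j) • D j := by
      rw [← mul_assoc, ιC_eC_mul, sub_mul, neg_mul, mul_assoc, smul_mul_assoc, one_mul]
    simp only [mul_add, mul_smul_comm, smul_add, h1, h2]
    module
  simp only [hterm, Finset.sum_add_distrib, ← Finset.smul_sum, ← Finset.mul_sum, hD, hsum,
    ← mul_assoc (ιC n x) (ιC n x), hx, smul_mul_assoc, one_mul, Finset.sum_const,
    Finset.card_univ, Fintype.card_fin, mul_zero, smul_zero, ← Nat.cast_smul_eq_nsmul ℂ]
  match_scalars <;> field_simp <;> ring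

/-- For `n ≥ 2` even, `a ∈ ℂⁿ` and `Ω ⊆ ℂⁿ` open, if
`F : Ω → Cl_n(ℂ)` is complex left monogenic then `z ↦ G(z+a)·F(ψ(z))` is complex left
monogenic on `Ω' = {z : s(z+a) ≠ 0 ∧ ψ(z) ∈ Ω}`. -/
theorem moebius_covariance_of_complex_left_monogenic (n : ℕ) (hn : 2 ≤ n) (heven : Even n)
    (a : Cn n) (Ω : Set (Cn n)) (hΩ : IsOpen Ω)
    (F : Cn n → Cl n) (hF : IsCLeftMonogenicOn n F Ω) :
    IsCLeftMonogenicOn n (fun z => Gc n (z + a) * F (mob n a z))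
      {z : Cn n | sC n (z + a) ≠ 0 ∧ mob n a z ∈ Ω} := by
  obtain ⟨DF, hDF, hmono⟩ := hF
  refine ⟨fun z j =>
    (-(n * (sC n (z + a) ^ (n / 2))⁻¹ * (sC n (z + a))⁻¹ * (z + a) j)) •
      (ιC n (z + a) * F (mob n a z)) +
    (sC n (z + a) ^ (n / 2))⁻¹ • (ιC n (eC n j) * F (mob n a z) + ιC n (z + a) *
      ((-(sC n (z + a))⁻¹) • DF (mob n a z) j + (2 * (z + a) j * (sC n (z + a))⁻¹ ^ 2) •
        ∑ i, (z + a) i • DF (mob n a z) i)), ?_, ?_⟩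
  · rintro φ z ⟨hz, hzΩ⟩
    obtain ⟨M, hM, hMe⟩ := hasFDerivAt_mob a z hz
    obtain ⟨L, hL, hLv⟩ := hasFDerivAt_ιC_add_mul a z (fun w => F (mob n a w))
      (fun v => ∑ i, M v i • DF (mob n a z) i) (fun φ => by
        obtain ⟨L, hL, hLv⟩ := hDF.hasFDerivAt φ hzΩ
        exact ⟨L.comp M, hL.comp z hM, fun v => hLv (M v)⟩) φ
    have hk : (n : ℂ) = 2 * (n / 2 : ℕ) := by exact_mod_cast (Nat.two_mul_div_two_of_even heven).symm
    have hpow := (hasDerivAt_inv (pow_ne_zero (n / 2) hz)).comp_hasFDerivAt z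
      ((hasFDerivAt_sC_add a z).pow (n / 2))
    have h := (hpow.mul hL).congr_of_eventuallyEq
      (f₁ := fun w => φ (Gc n (w + a) * F (mob n a w)))
      (.of_forall fun w => by simp [Gc, -map_add, -smul_add])
    refine ⟨h.differentiableAt, fun j => ?_⟩
    have hT : ∑ i, M (eC n j) i • DF (mob n a z) i =
        (-(sC n (z + a))⁻¹) • DF (mob n a z) j + (2 * (z + a) j * (sC n (z + a))⁻¹ ^ 2) •
        ∑ i, (z + a) i • DF (mob n a z) i := by
      simp only [hMe, PiLp.add_apply _ (_ • _), PiLp.smul_apply, smul_eq_mul, add_smul _ (_ * _),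
        Finset.sum_add_distrib, mul_smul _ (eC n j _), mul_smul _ ((z + a) _), Finset.smul_sum]
      simp [eC_apply]
    have hS : (∑ i, (2 * (z + a) i) • (EuclideanSpace.proj i : Cn n →L[ℂ] ℂ)) (eC n j) =
        2 * (z + a) j := by
      simp [eC_apply]
    have hm : n / 2 = n / 2 - 1 + 1 := by omega
    rw [h.fderiv, map_add φ, map_smul, map_smul, ← hT, ← hLv, hk]
    simp only [add_apply, smul_apply, hS, smul_eq_mul,
      Function.comp_apply, nsmul_eq_mul]
    generalize n / 2 = k at hm ⊢
    generalize k - 1 = m at hm ⊢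
    subst hm
    field_simp
    ring
  · rintro z ⟨hz, hzΩ⟩
    exact sum_ιC_mul_Gc_leibniz n (z + a) _ _ hz rfl _ _ (hmono _ hzΩ)
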